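/- Let W ∈ ∂θ(P) with P ≠ 0 and Q = P + W with SVD as in the context. Then D ∈ C_θ(P,W) if and only if there exists τ ∈ ℝ such that λ_{|α₁|}(S(D̃_{α₁α₁})) ≥ τ ≥ λ₁(S(D̃_{α₃α₃})) and S(D̃_{αα}) is the block-diagonal matrix Diag( S(D̃_{α₁α₁}), τ·I_{|α₂|}, S(D̃_{α₃α₃}) ) (i.e., all off-diagonal blocks of S(D̃_{αα}) between α₁, α₂, α₃ vanish and the α₂α₂ block equals τ·I). -/

import Mathlib

open Matrix Filter Set RealInnerProductSpace

noncomputable section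

/-- Trace inner product on real matrices: `⟨A,B⟩ = trace (Aᵀ B)`. -/
def minner {ι κ : Type*} [Fintype ι] [Fintype κ] (A B : Matrix ι κ ℝ) : ℝ :=
  (Aᵀ * B).trace

/-- Frobenius norm. -/
def fnorm {ι κ : Type*} [Fintype ι] [Fintype κ] (A : Matrix ι κ ℝ) : ℝ :=
  Real.sqrt (minner A A)

/-- Spectral norm (largest singular value), as the ℓ²-operator norm. -/
def specNorm {ι κ : Type*} [Fintype ι] [Fintype κ] (A : Matrix ι κ ℝ) : ℝ :=
  sSup {r : ℝ | ∃ x : κ → ℝ, ∑ j, x j ^ 2 = 1 ∧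
    r = Real.sqrt (∑ i, (∑ j, A i j * x j) ^ 2)}

/-- Convex subdifferential with respect to the trace inner product. -/
def subdiff {ι κ : Type*} [Fintype ι] [Fintype κ] (f : Matrix ι κ ℝ → ℝ)
    (X : Matrix ι κ ℝ) : Set (Matrix ι κ ℝ) :=
  {G | ∀ Y, f X + minner G (Y - X) ≤ f Y}

/-- One-sided directional derivative. -/
def dirDeriv {ι κ : Type*} [Fintype ι] [Fintype κ] (f : Matrix ι κ ℝ → ℝ)
    (X D : Matrix ι κ ℝ) : ℝ :=
  limUnder (nhdsWithin (0 : ℝ) (Set.Ioi 0)) fun t => (f (X + t • D) - f X) / t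

/-- Critical cone of the spectral norm θ at `P` for `W`. -/
def critTheta {ι κ : Type*} [Fintype ι] [Fintype κ] (P W : Matrix ι κ ℝ) :
    Set (Matrix ι κ ℝ) :=
  {D | dirDeriv specNorm P D = minner D W}

/-- Conjugate θ* of the spectral norm, as an extended-real-valued function
(it is the indicator of the nuclear norm unit ball). -/
def thetaStar {ι κ : Type*} [Fintype ι] [Fintype κ] (W : Matrix ι κ ℝ) : EReal :=
  ⨆ X : Matrix ι κ ℝ, ((minner W X - specNorm X : ℝ) : EReal)

/-- Lower directional epiderivative of an extended-real-valued function. -/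
def epiDeriv {ι κ : Type*} [Fintype ι] [Fintype κ] (g : Matrix ι κ ℝ → EReal)
    (X D : Matrix ι κ ℝ) : EReal :=
  liminf (fun p : ℝ × Matrix ι κ ℝ =>
      (((p.1)⁻¹ : ℝ) : EReal) * (g (X + p.1 • p.2) - g X))
    ((nhdsWithin (0 : ℝ) (Set.Ioi 0)) ×ˢ nhds D)

/-- Critical cone of θ* at `W` for `P`. -/
def critThetaStar {ι κ : Type*} [Fintype ι] [Fintype κ] (W P : Matrix ι κ ℝ) :
    Set (Matrix ι κ ℝ) :=
  {D | epiDeriv thetaStar W D = ((minner D P : ℝ) : EReal)}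

/-- Second-order directional derivative. -/
def dirDeriv2 {ι κ : Type*} [Fintype ι] [Fintype κ] (f : Matrix ι κ ℝ → ℝ)
    (X D W' : Matrix ι κ ℝ) : ℝ :=
  limUnder (nhdsWithin (0 : ℝ) (Set.Ioi 0)) fun t =>
    (f (X + t • D + (t ^ 2 / 2) • W') - f X - t * dirDeriv f X D) / (t ^ 2 / 2)

/-- The sigma term of θ: `ψ*_{(P,D)}(W) = (θ''(P;D,·))*(W)`. -/
def sigmaTheta {ι κ : Type*} [Fintype ι] [Fintype κ] (P D W : Matrix ι κ ℝ) : EReal :=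
  ⨆ Z : Matrix ι κ ℝ, ((minner W Z - dirDeriv2 specNorm P D Z : ℝ) : EReal)

/-- Lower second-order directional epiderivative of an EReal-valued function. -/
def epiDeriv2 {ι κ : Type*} [Fintype ι] [Fintype κ] (g : Matrix ι κ ℝ → EReal)
    (X D W' : Matrix ι κ ℝ) : EReal :=
  liminf (fun p : ℝ × Matrix ι κ ℝ =>
      ((2 / p.1 ^ 2 : ℝ) : EReal) *
        (g (X + p.1 • D + (p.1 ^ 2 / 2) • p.2) - g X - (p.1 : ℝ) * epiDeriv g X D))
    ((nhdsWithin (0 : ℝ) (Set.Ioi 0)) ×ˢ nhds W')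

/-- The sigma term of θ*: `φ*_{(W,H)}(P) = ((θ*)''(W;H,·))*(P)`. -/
def sigmaThetaStar {ι κ : Type*} [Fintype ι] [Fintype κ] (W H P : Matrix ι κ ℝ) : EReal :=
  ⨆ Z : Matrix ι κ ℝ, (((minner P Z : ℝ) : EReal) - epiDeriv2 thetaStar W H Z)

/-- Polar cone with respect to the trace inner product. -/
def polarCone {ι κ : Type*} [Fintype ι] [Fintype κ] (K : Set (Matrix ι κ ℝ)) :
    Set (Matrix ι κ ℝ) :=
  {H | ∀ D ∈ K, minner H D ≤ 0}

/-- Rectangular diagonal matrix `[Diag σ  0]`. -/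
def diagRect {m n : ℕ} (σ : Fin m → ℝ) : Matrix (Fin m) (Fin n) ℝ :=
  Matrix.of fun i j => if (j : ℕ) = (i : ℕ) then σ i else 0

/-- Symmetric part `S(A₁)` of the left m×m block of an m×n matrix. -/
def symLeft {m n : ℕ} (hmn : m ≤ n) (A : Matrix (Fin m) (Fin n) ℝ) :
    Matrix (Fin m) (Fin m) ℝ :=
  Matrix.of fun i j => (A i (Fin.castLE hmn j) + A j (Fin.castLE hmn i)) / 2

/-- Skew-symmetric part `T(A₁)` of the left m×m block of an m×n matrix. -/
def skewLeft {m n : ℕ} (hmn : m ≤ n) (A : Matrix (Fin m) (Fin n) ℝ) :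
    Matrix (Fin m) (Fin m) ℝ :=
  Matrix.of fun i j => (A i (Fin.castLE hmn j) - A j (Fin.castLE hmn i)) / 2

/-- Quadratic form `xᵀ A x`. -/
def quadForm {m : ℕ} (A : Matrix (Fin m) (Fin m) ℝ) (x : Fin m → ℝ) : ℝ :=
  ∑ i, ∑ j, x i * A i j * x j

/-- Proximal mapping. -/
def prox {ι κ : Type*} [Fintype ι] [Fintype κ] (f : Matrix ι κ ℝ → ℝ)
    (Z : Matrix ι κ ℝ) : Matrix ι κ ℝ :=
  Classical.epsilon fun Y =>
    ∀ X, f Y + (1 / 2) * fnorm (Y - Z) ^ 2 ≤ f X + (1 / 2) * fnorm (X - Z) ^ 2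

/-- Directional derivative of the proximal mapping. -/
def proxDeriv {ι κ : Type*} [Fintype ι] [Fintype κ] (f : Matrix ι κ ℝ → ℝ)
    (Z D : Matrix ι κ ℝ) : Matrix ι κ ℝ :=
  limUnder (nhdsWithin (0 : ℝ) (Set.Ioi 0)) fun t =>
    t⁻¹ • (prox f (Z + t • D) - prox f Z)

end

noncomputable section

/-- Classification of an index `i ∈ α` into the sub-blocks α₁ (value 1), α₂ (value 2),
α₃ (value 3), according to the singular value σ_i(W) ∈ {1} ∪ (0,1) ∪ {0},
i.e. according to whether σ_i(Q) = λ*+1, σ_i(Q) ∈ (λ*, λ*+1), or σ_i(Q) = λ*. -/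
def blkIdx {m : ℕ} (lam : ℝ) (σ : Fin m → ℝ) (i : Fin m) : ℕ :=
  if σ i = lam + 1 then 1 else if σ i = lam then 3 else 2

lemma sum_sq_single {ι : Type*} [Fintype ι] [DecidableEq ι] (i : ι) :
    ∑ j, (Pi.single i (1 : ℝ) : ι → ℝ) j ^ 2 = 1 := by
  simp [Pi.single_apply, ite_pow]

lemma isCompact_unitSphere {ι : Type*} [Fintype ι] :
    IsCompact {y : ι → ℝ | ∑ i, y i ^ 2 = 1} := by
  refine Metric.isCompact_of_isClosed_isBounded (isClosed_eq (by fun_prop) continuous_const) ?_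
  refine (Metric.isBounded_closedBall (x := (0 : ι → ℝ)) (r := 1)).subset fun y hy => ?_
  rw [mem_closedBall_zero_iff, pi_norm_le_iff_of_nonneg zero_le_one]
  intro i
  rw [Real.norm_eq_abs, ← sq_le_one_iff_abs_le_one]
  calc y i ^ 2 ≤ ∑ j, y j ^ 2 :=
        Finset.single_le_sum (fun j _ => sq_nonneg (y j)) (Finset.mem_univ i)
    _ = 1 := hy

lemma bddAbove_specNorm {ι κ : Type*} [Fintype ι] [Fintype κ] (A : Matrix ι κ ℝ) :
    BddAbove {r : ℝ | ∃ x : κ → ℝ, ∑ j, x j ^ 2 = 1 ∧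
      r = Real.sqrt (∑ i, (∑ j, A i j * x j) ^ 2)} := by
  refine ⟨Real.sqrt (∑ i, ∑ j, A i j ^ 2), ?_⟩
  rintro r ⟨x, hx, rfl⟩
  refine Real.sqrt_le_sqrt (Finset.sum_le_sum fun i _ => ?_)
  simpa [hx] using Finset.sum_mul_sq_le_sq_mul_sq Finset.univ (fun j => A i j) x

lemma bilin_le_specNorm {ι κ : Type*} [Fintype ι] [Fintype κ] (A : Matrix ι κ ℝ)
    {y : ι → ℝ} {z : κ → ℝ} (hy : ∑ i, y i ^ 2 = 1) (hz : ∑ j, z j ^ 2 = 1) :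
    y ⬝ᵥ A *ᵥ z ≤ specNorm A := by
  refine le_trans ?_ (le_csSup (bddAbove_specNorm A) ⟨z, hz, rfl⟩)
  refine Real.le_sqrt_of_sq_le ?_
  simpa [hy, dotProduct, mulVec] using
    Finset.sum_mul_sq_le_sq_mul_sq Finset.univ y (A *ᵥ z)

lemma specNorm_le_of_bilin_le {ι κ : Type*} [Fintype ι] [Fintype κ] [Nonempty ι] [Nonempty κ]
    (A : Matrix ι κ ℝ) {c : ℝ}
    (h : ∀ (y : ι → ℝ) (z : κ → ℝ), ∑ i, y i ^ 2 = 1 → ∑ j, z j ^ 2 = 1 → y ⬝ᵥ A *ᵥ z ≤ c) :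
    specNorm A ≤ c := by
  classical
  refine csSup_le ⟨_, Pi.single (Classical.arbitrary κ) 1, sum_sq_single _, rfl⟩ ?_
  rintro r ⟨x, hx, rfl⟩
  set N := Real.sqrt (∑ i, (∑ j, A i j * x j) ^ 2)
  have hsq : N ^ 2 = ∑ i, (A *ᵥ x) i ^ 2 :=
    Real.sq_sqrt (Finset.sum_nonneg fun i _ => sq_nonneg _)
  have hN : 0 ≤ N := Real.sqrt_nonneg _
  rcases hN.eq_or_lt with h0 | h0
  · have hAx : A *ᵥ x = 0 := by
      rw [← h0] at hsq
      funext i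
      have := (Finset.sum_eq_zero_iff_of_nonneg (fun i _ => sq_nonneg ((A *ᵥ x) i))).1
        (by rw [← hsq]; norm_num) i (Finset.mem_univ i)
      simpa using this
    have := h (Pi.single (Classical.arbitrary ι) 1) x (sum_sq_single _) hx
    rw [hAx, dotProduct_zero] at this
    rwa [← h0]
  · have := h (fun i => N⁻¹ * (A *ᵥ x) i) x (by
      simp_rw [mul_pow]
      rw [← Finset.mul_sum, ← hsq, ← mul_pow, inv_mul_cancel₀ h0.ne', one_pow]) hx
    have e : (fun i => N⁻¹ * (A *ᵥ x) i) ⬝ᵥ A *ᵥ x = N := by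
      simp_rw [dotProduct, mul_assoc, ← sq]
      rw [← Finset.mul_sum, ← hsq, sq, inv_mul_cancel_left₀ h0.ne']
    rwa [e] at this

/-- Danskin's theorem for the maximum of `f + t • h` over a compact set, at `t = 0`. -/
lemma tendsto_slope_of_isLUB {X : Type*} [TopologicalSpace X] {K : Set X} (hK : IsCompact K)
    {f h : X → ℝ} (hf : Continuous f) (hh : Continuous h) {lam g : ℝ}
    (hle : ∀ ξ ∈ K, f ξ ≤ lam) (hg : ∀ ξ ∈ K, f ξ = lam → h ξ ≤ g)
    (hex : ∃ ξ ∈ K, f ξ = lam ∧ h ξ = g) {φ : ℝ → ℝ}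
    (hφ : ∀ t, 0 < t → IsLUB ((fun ξ => f ξ + t * h ξ) '' K) (φ t)) :
    Tendsto (fun t => (φ t - lam) / t) (nhdsWithin 0 (Set.Ioi 0)) (nhds g) := by
  obtain ⟨ξ₀, hξK, hξf, hξh⟩ := hex
  have lower : ∀ t, 0 < t → g ≤ (φ t - lam) / t := by
    intro t ht
    have : f ξ₀ + t * h ξ₀ ≤ φ t := (hφ t ht).1 ⟨ξ₀, hξK, rfl⟩
    rw [le_div_iff₀ ht]
    rw [hξf, hξh] at this
    linarith
  obtain ⟨H, hH⟩ := (hK.image hh).bddAbove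
  have upper : ∀ ε > 0, ∀ᶠ t in nhdsWithin (0 : ℝ) (Set.Ioi 0), (φ t - lam) / t ≤ g + ε := by
    intro ε hε
    have hcpt : IsCompact (K ∩ {ξ | g + ε ≤ h ξ}) :=
      hK.inter_right (isClosed_le continuous_const hh)
    obtain ⟨δ, hδ, hgap⟩ : ∃ δ > 0, ∀ ξ ∈ K ∩ {ξ | g + ε ≤ h ξ}, f ξ ≤ lam - δ := by
      rcases (K ∩ {ξ | g + ε ≤ h ξ}).eq_empty_or_nonempty with he | hne
      · exact ⟨1, one_pos, by simp [he]⟩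
      · obtain ⟨ξ₁, ⟨h1K, h1⟩, hmax⟩ := hcpt.exists_isMaxOn hne hf.continuousOn
        refine ⟨lam - f ξ₁, sub_pos.2 ((hle _ h1K).lt_of_ne fun e => ?_), fun ξ hξ => ?_⟩
        · have := hg _ h1K e
          have h1' : g + ε ≤ h ξ₁ := h1
          linarith
        · have : f ξ ≤ f ξ₁ := hmax hξ
          linarith
    have small : ∀ᶠ t in nhdsWithin (0 : ℝ) (Set.Ioi 0), t * (H - (g + ε)) < δ := by
      have : Tendsto (fun t : ℝ => t * (H - (g + ε))) (nhdsWithin 0 (Set.Ioi 0))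
          (nhds (0 * (H - (g + ε)))) :=
        (Continuous.tendsto (by fun_prop) 0).mono_left nhdsWithin_le_nhds
      rw [zero_mul] at this
      exact this.eventually_lt_const hδ
    filter_upwards [small, self_mem_nhdsWithin] with t hsm ht
    have ht : 0 < t := ht
    rw [div_le_iff₀ ht, sub_le_iff_le_add]
    refine (hφ t ht).2 ?_
    rintro _ ⟨ξ, hξ, rfl⟩
    show f ξ + t * h ξ ≤ _
    rcases le_total (g + ε) (h ξ) with hc | hc
    · have h1 := hgap ξ ⟨hξ, hc⟩
      have h2 := mul_le_mul_of_nonneg_left (hH ⟨ξ, hξ, rfl⟩ : h ξ ≤ H) ht.le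
      linarith
    · have h1 := hle ξ hξ
      have h2 := mul_le_mul_of_nonneg_left hc ht.le
      linarith
  rw [Metric.tendsto_nhds]
  intro ε hε
  filter_upwards [upper (ε / 2) (by linarith), self_mem_nhdsWithin] with t hu ht
  have hl := lower t ht
  rw [Real.dist_eq, abs_lt]
  constructor <;> linarith

lemma sum_sq_orthogonal_mulVec {k : ℕ} {U : Matrix (Fin k) (Fin k) ℝ} (hU : Uᵀ * U = 1)
    (x : Fin k → ℝ) : ∑ i, (U *ᵥ x) i ^ 2 = ∑ i, x i ^ 2 := by
  have h : (U *ᵥ x) ⬝ᵥ (U *ᵥ x) = x ⬝ᵥ x := by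
    rw [dotProduct_mulVec, vecMul_mulVec, ← dotProduct_mulVec, hU, one_mulVec]
  simpa [dotProduct, sq] using h

lemma sum_castLE_of_eq_zero {m n : ℕ} (hmn : m ≤ n) (f : Fin n → ℝ)
    (hf : ∀ j, j ∉ Set.range (Fin.castLE hmn) → f j = 0) :
    ∑ j, f j = ∑ i, f (Fin.castLE hmn i) :=
  (Fintype.sum_of_injective _ (Fin.castLE_injective hmn) _ f hf fun _ => rfl).symm

lemma diagRect_mulVec {m n : ℕ} (hmn : m ≤ n) (p : Fin m → ℝ) (z : Fin n → ℝ) (i : Fin m) :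
    ((diagRect p : Matrix (Fin m) (Fin n) ℝ) *ᵥ z) i = p i * z (Fin.castLE hmn i) := by
  rw [mulVec, dotProduct, Finset.sum_eq_single (Fin.castLE hmn i)]
  · simp [diagRect]
  · intro j _ hj
    have : (j : ℕ) ≠ i := fun e => hj (Fin.ext e)
    simp [diagRect, this]
  · simp

lemma bilin_transform {m n : ℕ} (U : Matrix (Fin m) (Fin m) ℝ) (V : Matrix (Fin n) (Fin n) ℝ)
    (A : Matrix (Fin m) (Fin n) ℝ) (y : Fin m → ℝ) (z : Fin n → ℝ) :
    (U *ᵥ y) ⬝ᵥ A *ᵥ (V *ᵥ z) = y ⬝ᵥ (Uᵀ * A * V) *ᵥ z := by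
  rw [← mulVec_mulVec, ← mulVec_mulVec, dotProduct_mulVec y, vecMul_transpose]

lemma quadForm_symLeft {m n : ℕ} (hmn : m ≤ n) (M : Matrix (Fin m) (Fin n) ℝ) (y : Fin m → ℝ) :
    quadForm (symLeft hmn M) y = ∑ i, ∑ j, y i * M i (Fin.castLE hmn j) * y j := by
  have hswap : ∑ i, ∑ j, y i * M j (Fin.castLE hmn i) * y j =
      ∑ i, ∑ j, y i * M i (Fin.castLE hmn j) * y j := by
    rw [Finset.sum_comm]
    exact Finset.sum_congr rfl fun i _ => Finset.sum_congr rfl fun j _ => by ring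
  have hsplit : quadForm (symLeft hmn M) y =
      (∑ i, ∑ j, y i * M i (Fin.castLE hmn j) * y j +
        ∑ i, ∑ j, y i * M j (Fin.castLE hmn i) * y j) / 2 := by
    simp only [quadForm, symLeft, of_apply, ← Finset.sum_add_distrib, Finset.sum_div]
    exact Finset.sum_congr rfl fun i _ => Finset.sum_congr rfl fun j _ => by ring
  rw [hsplit, hswap]
  ring

lemma bilin_eq_quadForm {m n : ℕ} (hmn : m ≤ n) (M : Matrix (Fin m) (Fin n) ℝ)
    {y : Fin m → ℝ} {z : Fin n → ℝ} (hyz : ∀ i, z (Fin.castLE hmn i) = y i)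
    (hz : ∀ j, j ∉ Set.range (Fin.castLE hmn) → z j = 0) :
    y ⬝ᵥ M *ᵥ z = quadForm (symLeft hmn M) y := by
  rw [quadForm_symLeft]
  refine Finset.sum_congr rfl fun i _ => ?_
  rw [mulVec, dotProduct, sum_castLE_of_eq_zero hmn _ fun j hj => by rw [hz j hj, mul_zero],
    Finset.mul_sum]
  exact Finset.sum_congr rfl fun j _ => by rw [hyz, mul_assoc]

lemma exists_zero_extension {m n : ℕ} (hmn : m ≤ n) (y : Fin m → ℝ) :
    ∃ z : Fin n → ℝ, (∀ i, z (Fin.castLE hmn i) = y i) ∧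
      ∀ j, j ∉ Set.range (Fin.castLE hmn) → z j = 0 :=
  ⟨Function.extend (Fin.castLE hmn) y 0, fun i => (Fin.castLE_injective hmn).extend_apply y 0 i,
    fun j hj => by rw [Function.extend_apply' _ _ _ hj]; rfl⟩

/-- Unit vectors attaining the top singular value of `[Diag p  0]`. -/
lemma eq_of_bilin_diagRect_eq {m n : ℕ} (hmn : m ≤ n) {p : Fin m → ℝ} {lam : ℝ}
    (hlam : 0 < lam) (hp0 : ∀ i, 0 ≤ p i) (hp : ∀ i, p i ≤ lam) {y : Fin m → ℝ} {z : Fin n → ℝ}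
    (hy : ∑ i, y i ^ 2 = 1) (hz : ∑ j, z j ^ 2 = 1)
    (h : ∑ i, y i * (p i * z (Fin.castLE hmn i)) = lam) :
    (∀ i, z (Fin.castLE hmn i) = y i) ∧ (∀ j, j ∉ Set.range (Fin.castLE hmn) → z j = 0) ∧
      ∀ i, p i < lam → y i = 0 := by
  set z₁ : Fin m → ℝ := fun i => z (Fin.castLE hmn i) with hz₁
  set R := Finset.univ.map (Fin.castLEEmb hmn) with hR
  have hRsum : ∑ j ∈ R, z j ^ 2 = ∑ i, z₁ i ^ 2 := by simp [hR, hz₁]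
  have hadd : ∑ j ∈ Finset.univ \ R, z j ^ 2 + ∑ i, z₁ i ^ 2 = 1 := by
    rw [← hRsum, Finset.sum_sdiff (Finset.subset_univ R), hz]
  set r := ∑ j ∈ Finset.univ \ R, z j ^ 2 with hr
  have hr0 : 0 ≤ r := Finset.sum_nonneg fun j _ => sq_nonneg _
  set T : Fin m → ℝ := fun i =>
    p i * (y i - z₁ i) ^ 2 + (lam - p i) * (y i ^ 2 + z₁ i ^ 2) with hT
  have hT0 : ∀ i, 0 ≤ T i := fun i =>
    add_nonneg (mul_nonneg (hp0 i) (sq_nonneg _))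
      (mul_nonneg (sub_nonneg.2 (hp i)) (by positivity))
  have hTsum : ∑ i, T i = lam * ∑ i, y i ^ 2 + lam * ∑ i, z₁ i ^ 2 -
      2 * ∑ i, y i * (p i * z (Fin.castLE hmn i)) := by
    simp only [Finset.mul_sum, ← Finset.sum_add_distrib, ← Finset.sum_sub_distrib]
    exact Finset.sum_congr rfl fun i _ => by simp only [hT, hz₁]; ring
  rw [h, hy] at hTsum
  have hTn : 0 ≤ ∑ i, T i := Finset.sum_nonneg fun i _ => hT0 i
  have hlr : 0 ≤ lam * r := mul_nonneg hlam.le hr0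
  have hz₁r : ∑ i, z₁ i ^ 2 = 1 - r := by linarith
  rw [hz₁r] at hTsum
  have hTz : ∑ i, T i = 0 := by nlinarith
  have hrz : r = 0 := by nlinarith
  have hTi : ∀ i, T i = 0 := fun i =>
    (Finset.sum_eq_zero_iff_of_nonneg fun i _ => hT0 i).1 hTz i (Finset.mem_univ i)
  have hlt : ∀ i, p i < lam → y i = 0 ∧ z₁ i = 0 := by
    intro i hi
    have h1 : 0 ≤ p i * (y i - z₁ i) ^ 2 := mul_nonneg (hp0 i) (sq_nonneg _)
    have h2 : (lam - p i) * (y i ^ 2 + z₁ i ^ 2) ≤ 0 := by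
      have := hTi i
      simp only [hT] at this
      linarith
    have h3 : y i ^ 2 + z₁ i ^ 2 ≤ 0 := nonpos_of_mul_nonpos_right h2 (sub_pos.2 hi)
    constructor <;> nlinarith [sq_nonneg (y i), sq_nonneg (z₁ i)]
  refine ⟨fun i => ?_, fun j hj => ?_, fun i hi => (hlt i hi).1⟩
  · rcases (hp i).lt_or_eq with hi | hi
    · obtain ⟨h1, h2⟩ := hlt i hi
      exact h2.trans h1.symm
    · have := hTi i
      simp only [hT, hi, sub_self, zero_mul, add_zero, mul_eq_zero, hlam.ne', false_or] at this
      have := pow_eq_zero_iff (two_ne_zero) |>.1 this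
      exact (sub_eq_zero.1 this).symm
  · have hj' : j ∈ Finset.univ \ R := by
      simp only [hR, Finset.mem_sdiff, Finset.mem_univ, true_and, Finset.mem_map, not_exists]
      exact fun i e => hj ⟨i, e⟩
    have := (Finset.sum_eq_zero_iff_of_nonneg fun j _ => sq_nonneg (z j)).1 hrz j hj'
    exact pow_eq_zero_iff (two_ne_zero) |>.1 this

lemma quadForm_eq_dotProduct {m : ℕ} (S : Matrix (Fin m) (Fin m) ℝ) (x : Fin m → ℝ) :
    quadForm S x = x ⬝ᵥ S *ᵥ x := by
  simp only [quadForm, dotProduct, mulVec, Finset.mul_sum, mul_assoc]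

lemma quadForm_le_mul_sum_sq {m : ℕ} {S : Matrix (Fin m) (Fin m) ℝ} {p : Fin m → Prop} {c : ℝ}
    (h : ∀ x : Fin m → ℝ, (∀ i, p i → x i = 0) → ∑ i, x i ^ 2 = 1 → quadForm S x ≤ c)
    (x : Fin m → ℝ) (hx : ∀ i, p i → x i = 0) : quadForm S x ≤ c * ∑ i, x i ^ 2 := by
  set N := Real.sqrt (∑ i, x i ^ 2)
  have hsq : N ^ 2 = ∑ i, x i ^ 2 := Real.sq_sqrt (Finset.sum_nonneg fun i _ => sq_nonneg _)
  have hN : 0 ≤ N := Real.sqrt_nonneg _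
  rcases hN.eq_or_lt with h0 | h0
  · rw [← h0] at hsq
    have hx0 : x = 0 := by
      funext i
      simpa using (Finset.sum_eq_zero_iff_of_nonneg (fun i _ => sq_nonneg (x i))).1
        (by rw [← hsq]; norm_num) i (Finset.mem_univ i)
    simp [hx0, quadForm]
  · have h1 := h (N⁻¹ • x) (fun i hi => by simp [hx i hi]) (by
      simp only [Pi.smul_apply, smul_eq_mul, mul_pow]
      rw [← Finset.mul_sum, ← hsq, ← mul_pow, inv_mul_cancel₀ h0.ne', one_pow])
    rw [quadForm_eq_dotProduct, mulVec_smul, dotProduct_smul, smul_dotProduct,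
      ← quadForm_eq_dotProduct, smul_eq_mul, smul_eq_mul, ← mul_assoc, ← mul_inv, ← sq,
      inv_mul_le_iff₀ (by positivity), hsq] at h1
    linarith

lemma quadForm_single {m : ℕ} (S : Matrix (Fin m) (Fin m) ℝ) (i : Fin m) :
    quadForm S (Pi.single i 1) = S i i := by
  simp [quadForm_eq_dotProduct]

/-- A diagonal entry equal to the maximal Rayleigh quotient decouples from the other entries. -/
lemma offDiag_eq_zero_of_diag_eq_max {m : ℕ} {S : Matrix (Fin m) (Fin m) ℝ}
    (hS : ∀ i j, S i j = S j i) {p : Fin m → Prop} {g : ℝ}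
    (h : ∀ x : Fin m → ℝ, (∀ i, p i → x i = 0) → quadForm S x ≤ g * ∑ i, x i ^ 2)
    {i j : Fin m} (hi : ¬ p i) (hj : ¬ p j) (hij : i ≠ j) (hii : S i i = g) : S i j = 0 := by
  have key : ∀ s : ℝ, S i i + 2 * s * S i j + s ^ 2 * S j j ≤ g * (1 + s ^ 2) := by
    intro s
    have hx := h (Pi.single i 1 + Pi.single j s) (fun k hk => by
      have h1 : k ≠ i := fun e => hi (e ▸ hk)
      have h2 : k ≠ j := fun e => hj (e ▸ hk)
      simp [h1, h2])
    have e1 : quadForm S (Pi.single i 1 + Pi.single j s) =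
        S i i + 2 * s * S i j + s ^ 2 * S j j := by
      rw [quadForm_eq_dotProduct]
      simp [mulVec_add, add_dotProduct, dotProduct_add, hS j i]
      ring
    have e2 : ∑ k, (Pi.single i 1 + Pi.single j s : Fin m → ℝ) k ^ 2 = 1 + s ^ 2 := by
      have : ∀ v : Fin m → ℝ, ∑ k, v k ^ 2 = v ⬝ᵥ v := fun v => by simp [dotProduct, sq]
      rw [this]
      simp [dotProduct_add, hij, hij.symm, sq]
    rwa [e1, e2] at hx
  have hjj : S j j ≤ g := by
    have := h (Pi.single j 1) (fun k hk => by
      have h2 : k ≠ j := fun e => hj (e ▸ hk)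
      simp [h2])
    rwa [quadForm_single, sum_sq_single, mul_one] at this
  set k := g - S j j with hk
  have hk0 : 0 ≤ k := sub_nonneg.2 hjj
  have h1 := key (S i j / (k + 1))
  rw [hii] at h1
  have h2 : 2 * (S i j / (k + 1)) * S i j ≤ (S i j / (k + 1)) ^ 2 * k := by
    rw [hk] at h1 ⊢
    linarith
  have hpos : 0 < k + 1 := by linarith
  have hb : S i j = S i j / (k + 1) * (k + 1) := by field_simp
  set u := S i j / (k + 1)
  have hu : u = 0 := by
    rw [hb] at h2
    nlinarith [mul_nonneg (sq_nonneg u) hk0, sq_nonneg u]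
  rw [hb, hu, zero_mul]

/-- If the indices with `lam < σ i` decouple with diagonal value `G`, the Rayleigh quotient on the
indices with `lam ≤ σ i` is bounded by `G`. -/
lemma quadForm_le_of_decoupled {m : ℕ} {S : Matrix (Fin m) (Fin m) ℝ} {σ : Fin m → ℝ}
    {lam τ G : ℝ} (hτG : τ ≤ G)
    (h₃ : ∀ x : Fin m → ℝ, (∀ i, σ i ≠ lam → x i = 0) → ∑ i, x i ^ 2 = 1 → quadForm S x ≤ τ)
    (hl : ∀ i j, lam < σ i → lam ≤ σ j → S i j = if i = j then G else 0)
    (hr : ∀ i j, lam < σ i → lam ≤ σ j → S j i = if i = j then G else 0)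
    (x : Fin m → ℝ) (hx : ∀ i, σ i < lam → x i = 0) (hx1 : ∑ i, x i ^ 2 = 1) :
    quadForm S x ≤ G := by
  set x₃ : Fin m → ℝ := fun i => if σ i = lam then x i else 0 with hx₃
  have hdecomp : quadForm S x = quadForm S x₃ + G * (∑ i, x i ^ 2 - ∑ i, x₃ i ^ 2) := by
    have hdiag : G * (∑ i, x i ^ 2 - ∑ i, x₃ i ^ 2) =
        ∑ i, ∑ j, if i = j then G * (x i ^ 2 - x₃ i ^ 2) else 0 := by
      simp [← Finset.sum_sub_distrib, Finset.mul_sum]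
    rw [hdiag]
    simp only [quadForm, ← Finset.sum_add_distrib]
    refine Finset.sum_congr rfl fun i _ => Finset.sum_congr rfl fun j _ => ?_
    rcases lt_trichotomy (σ i) lam with hi | hi | hi
    · have h3i : x₃ i = 0 := by simp [hx₃, hi.ne]
      simp [hx i hi, h3i]
    · have h3i : x₃ i = x i := by simp [hx₃, hi]
      rcases lt_trichotomy (σ j) lam with hj | hj | hj
      · have h3j : x₃ j = 0 := by simp [hx₃, hj.ne]
        simp [hx j hj, h3i, h3j]
      · have h3j : x₃ j = x j := by simp [hx₃, hj]
        simp [h3i, h3j]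
      · have h3j : x₃ j = 0 := by simp [hx₃, hj.ne']
        have hji : j ≠ i := by rintro rfl; exact hj.ne' hi
        simp [hr j i hj hi.ge, hji, h3i, h3j]
    · have h3i : x₃ i = 0 := by simp [hx₃, hi.ne']
      rcases lt_or_ge (σ j) lam with hj | hj
      · have hij : i ≠ j := by rintro rfl; exact lt_asymm hi hj
        simp [hx j hj, h3i, hij]
      · rw [hl i j hi hj, h3i]
        split_ifs with hij
        · subst hij; ring
        · ring
  have hq := quadForm_le_mul_sum_sq h₃ x₃ (fun i hi => by simp [hx₃, hi])
  have h0 : 0 ≤ ∑ i, x₃ i ^ 2 := Finset.sum_nonneg fun i _ => sq_nonneg _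
  rw [hdecomp, hx1]
  nlinarith [mul_le_mul_of_nonneg_right hτG h0]

/-- The equality case of `∑ wᵢ Sᵢᵢ ≤ λ_max(S_αα)` for weights `wᵢ = (σᵢ - lam)₊` summing to one. -/
lemma max_eq_weighted_diag_iff {m : ℕ} {S : Matrix (Fin m) (Fin m) ℝ}
    (hS : ∀ i j, S i j = S j i) {σ : Fin m → ℝ} {lam g : ℝ}
    (hw : ∑ i, max (σ i - lam) 0 = 1)
    (hg : ∀ x : Fin m → ℝ, (∀ i, σ i < lam → x i = 0) → ∑ i, x i ^ 2 = 1 → quadForm S x ≤ g)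
    (hex : ∃ x : Fin m → ℝ, (∀ i, σ i < lam → x i = 0) ∧ ∑ i, x i ^ 2 = 1 ∧ quadForm S x = g) :
    g = ∑ i, max (σ i - lam) 0 * S i i ↔
      ∃ τ : ℝ,
        (∀ x : Fin m → ℝ, (∀ i, σ i ≠ lam + 1 → x i = 0) → ∑ i, x i ^ 2 = 1 →
          τ ≤ quadForm S x) ∧
        (∀ x : Fin m → ℝ, (∀ i, σ i ≠ lam → x i = 0) → ∑ i, x i ^ 2 = 1 →
          quadForm S x ≤ τ) ∧
        (∀ i j : Fin m, lam ≤ σ i → lam ≤ σ j →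
          (blkIdx lam σ i ≠ blkIdx lam σ j → S i j = 0) ∧
          (blkIdx lam σ i = 2 → blkIdx lam σ j = 2 → S i j = if i = j then τ else 0)) := by
  have hdiag : ∀ i, lam ≤ σ i → S i i ≤ g := by
    intro i hi
    rw [← quadForm_single S]
    refine hg _ (fun k hk => ?_) (sum_sq_single i)
    have : k ≠ i := by rintro rfl; exact hk.not_ge hi
    simp [this]
  have hw0 : ∀ i, 0 ≤ max (σ i - lam) 0 := fun i => le_max_right _ _
  constructor
  · intro heq
    have hterm : ∀ i, 0 ≤ max (σ i - lam) 0 * (g - S i i) := by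
      intro i
      rcases le_total lam (σ i) with hi | hi
      · exact mul_nonneg (hw0 i) (sub_nonneg.2 (hdiag i hi))
      · rw [max_eq_right (by linarith), zero_mul]
    have hsum : ∑ i, max (σ i - lam) 0 * (g - S i i) = 0 := by
      simp only [mul_sub, Finset.sum_sub_distrib, ← Finset.sum_mul]
      rw [hw, one_mul, ← heq, sub_self]
    have hii : ∀ i, lam < σ i → S i i = g := by
      intro i hi
      have h0 := (Finset.sum_eq_zero_iff_of_nonneg fun i _ => hterm i).1 hsum i (Finset.mem_univ i)
      rw [max_eq_left (by linarith)] at h0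
      rcases mul_eq_zero.1 h0 with h1 | h1 <;> linarith
    have hoff : ∀ i j, lam < σ i → lam ≤ σ j → i ≠ j → S i j = 0 := fun i j hi hj hij =>
      offDiag_eq_zero_of_diag_eq_max hS (quadForm_le_mul_sum_sq hg) hi.le.not_gt hj.not_gt hij
        (hii i hi)
    refine ⟨g, fun x hx hx1 => ?_, fun x hx hx1 => hg x (fun i hi => hx i hi.ne) hx1,
      fun i j hi hj => ⟨fun hb => ?_, fun hbi hbj => ?_⟩⟩
    · have : quadForm S x = ∑ i, ∑ j, if i = j then g * x i ^ 2 else 0 := by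
        refine Finset.sum_congr rfl fun i _ => Finset.sum_congr rfl fun j _ => ?_
        by_cases hi : σ i = lam + 1
        · by_cases hj : σ j = lam + 1
          · split_ifs with hij
            · subst hij
              rw [hii i (by linarith)]
              ring
            · rw [hoff i j (by linarith) (by linarith) hij]
              ring
          · have hij : i ≠ j := by rintro rfl; exact hj hi
            simp [hx j hj, hij]
        · simp [hx i hi]
      rw [this]
      simp [← Finset.mul_sum, hx1]
    · have hij : i ≠ j := by rintro rfl; exact hb rfl
      rcases hi.lt_or_eq with hi' | hi'
      · exact hoff i j hi' hj hij
      · rcases hj.lt_or_eq with hj' | hj'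
        · rw [hS]
          exact hoff j i hj' hi hij.symm
        · exact absurd (by simp [blkIdx, ← hi', ← hj']) hb
    · have hi' : lam < σ i := by
        refine hi.lt_of_ne fun e => ?_
        simp [blkIdx, ← e] at hbi
      split_ifs with hij
      · subst hij
        exact hii i hi'
      · exact hoff i j hi' hj hij
  · rintro ⟨τ, h₁, h₃, hb⟩
    obtain ⟨G, hτG, hl⟩ : ∃ G, τ ≤ G ∧
        ∀ i j, lam < σ i → lam ≤ σ j → S i j = if i = j then G else 0 := by
      by_cases h : ∃ i₀, σ i₀ = lam + 1
      · obtain ⟨i₀, hi₀⟩ := h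
        have huniq : ∀ i, lam < σ i → i = i₀ := by
          intro i hi
          by_contra hne
          have h2 := Finset.sum_le_sum_of_subset_of_nonneg (Finset.subset_univ {i, i₀})
            (fun k _ _ => hw0 k)
          rw [Finset.sum_pair hne, hw, hi₀, max_eq_left (by linarith),
            max_eq_left (by linarith)] at h2
          linarith
        refine ⟨S i₀ i₀, ?_, fun i j hi hj => ?_⟩
        · rw [← quadForm_single S]
          refine h₁ _ (fun k hk => ?_) (sum_sq_single i₀)
          have : k ≠ i₀ := by rintro rfl; exact hk hi₀
          simp [this]
        · obtain rfl := huniq i hi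
          split_ifs with hij
          · rw [← hij]
          · have hj' : σ j = lam :=
              le_antisymm (not_lt.1 fun h => hij (huniq j h).symm) hj
            exact (hb i j hi.le hj).1 (by simp [blkIdx, hi₀, hj'])
      · push Not at h
        refine ⟨τ, le_rfl, fun i j hi hj => ?_⟩
        have hbi : blkIdx lam σ i = 2 := by simp [blkIdx, h i, hi.ne']
        rcases hj.lt_or_eq with hj' | hj'
        · exact (hb i j hi.le hj).2 hbi (by simp [blkIdx, h j, hj'.ne'])
        · have hij : i ≠ j := by rintro rfl; exact hi.ne hj'
          rw [if_neg hij]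
          exact (hb i j hi.le hj).1 (by rw [hbi]; simp [blkIdx, ← hj'])
    have hwsum : ∑ i, max (σ i - lam) 0 * S i i = G := by
      rw [← one_mul G, ← hw, Finset.sum_mul]
      refine Finset.sum_congr rfl fun i _ => ?_
      rcases lt_or_ge lam (σ i) with hi | hi
      · rw [hl i i hi hi.le, if_pos rfl]
      · rw [max_eq_right (by linarith), zero_mul, zero_mul]
    rw [hwsum]
    refine le_antisymm ?_ ?_
    · obtain ⟨x, hx, hx1, rfl⟩ := hex
      exact quadForm_le_of_decoupled hτG h₃ hl (fun i j hi hj => by rw [hS]; exact hl i j hi hj)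
        x hx hx1
    · calc G = ∑ i, max (σ i - lam) 0 * S i i := hwsum.symm
        _ ≤ ∑ i, max (σ i - lam) 0 * g := by
          refine Finset.sum_le_sum fun i _ => ?_
          rcases le_total lam (σ i) with hi | hi
          · exact mul_le_mul_of_nonneg_left (hdiag i hi) (hw0 i)
          · rw [max_eq_right (by linarith), zero_mul, zero_mul]
        _ = g := by rw [← Finset.sum_mul, hw, one_mul]

lemma minner_mul_diagRect_mul {m n : ℕ} (hmn : m ≤ n) (U : Matrix (Fin m) (Fin m) ℝ)
    (V : Matrix (Fin n) (Fin n) ℝ) (w : Fin m → ℝ) (D : Matrix (Fin m) (Fin n) ℝ) :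
    minner D (U * (diagRect w : Matrix (Fin m) (Fin n) ℝ) * Vᵀ) =
      ∑ i, w i * symLeft hmn (Uᵀ * D * V) i i := by
  have h : minner D (U * (diagRect w : Matrix (Fin m) (Fin n) ℝ) * Vᵀ) =
      ((diagRect w : Matrix (Fin m) (Fin n) ℝ) * (Uᵀ * D * V)ᵀ).trace := by
    rw [minner, ← trace_transpose (Dᵀ * _), trace_mul_comm _ (Uᵀ * D * V)ᵀ,
      ← trace_transpose ((Uᵀ * D * V)ᵀ * _)]
    simp only [transpose_mul, transpose_transpose]
    rw [Matrix.mul_assoc, trace_mul_comm V]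
    simp only [Matrix.mul_assoc]
  rw [h, trace]
  refine Finset.sum_congr rfl fun i _ => ?_
  have h2 := diagRect_mulVec hmn w ((Uᵀ * D * V) i) i
  rw [diag_apply, mul_apply]
  simp only [mulVec, dotProduct] at h2
  simp only [transpose_apply, symLeft, of_apply, add_self_div_two]
  exact h2

lemma sum_sq_zero_extension {m n : ℕ} (hmn : m ≤ n) {y : Fin m → ℝ} {z : Fin n → ℝ}
    (hyz : ∀ i, z (Fin.castLE hmn i) = y i)
    (hz : ∀ j, j ∉ Set.range (Fin.castLE hmn) → z j = 0) : ∑ j, z j ^ 2 = ∑ i, y i ^ 2 := by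
  rw [sum_castLE_of_eq_zero hmn _ fun j hj => by rw [hz j hj]; norm_num]
  simp only [hyz]

/-- The directional derivative of the spectral norm is the largest Rayleigh quotient over the
singular subspace of the top singular value. -/
lemma dirDeriv_specNorm_eq {m n : ℕ} (hmn : m ≤ n) [Nonempty (Fin m)]
    {P : Matrix (Fin m) (Fin n) ℝ} {U : Matrix (Fin m) (Fin m) ℝ} {V : Matrix (Fin n) (Fin n) ℝ}
    {σ : Fin m → ℝ} (hU : Uᵀ * U = 1) (hV : Vᵀ * V = 1) (hσ0 : ∀ i, 0 ≤ σ i)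
    {lam : ℝ} (hlam0 : 0 < lam) (hlamP : lam = specNorm P)
    (hPdec : P = U * (diagRect (fun i => min (σ i) lam) : Matrix (Fin m) (Fin n) ℝ) * Vᵀ)
    (D : Matrix (Fin m) (Fin n) ℝ) {g : ℝ}
    (hg : ∀ x : Fin m → ℝ, (∀ i, σ i < lam → x i = 0) → ∑ i, x i ^ 2 = 1 →
      quadForm (symLeft hmn (Uᵀ * D * V)) x ≤ g)
    (hex : ∃ x : Fin m → ℝ, (∀ i, σ i < lam → x i = 0) ∧ ∑ i, x i ^ 2 = 1 ∧
      quadForm (symLeft hmn (Uᵀ * D * V)) x = g) :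
    dirDeriv specNorm P D = g := by
  have : Nonempty (Fin n) := ⟨Fin.castLE hmn (Classical.arbitrary _)⟩
  have hUU : U * Uᵀ = 1 := mul_eq_one_comm.1 hU
  have hVV : V * Vᵀ = 1 := mul_eq_one_comm.1 hV
  have hP' : Uᵀ * P * V =
      (diagRect (fun i => min (σ i) lam) : Matrix (Fin m) (Fin n) ℝ) := by
    rw [hPdec, Matrix.mul_assoc, Matrix.mul_assoc, hV, Matrix.mul_one, ← Matrix.mul_assoc, hU,
      Matrix.one_mul]
  have hbilP : ∀ y z, (U *ᵥ y) ⬝ᵥ P *ᵥ (V *ᵥ z) =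
      ∑ i, y i * (min (σ i) lam * z (Fin.castLE hmn i)) := by
    intro y z
    rw [bilin_transform, hP']
    exact Finset.sum_congr rfl fun i _ => by rw [diagRect_mulVec hmn]
  refine Tendsto.limUnder_eq ?_
  rw [← hlamP]
  refine tendsto_slope_of_isLUB
    (K := {y : Fin m → ℝ | ∑ i, y i ^ 2 = 1} ×ˢ {z : Fin n → ℝ | ∑ j, z j ^ 2 = 1})
    (f := fun ξ => ξ.1 ⬝ᵥ P *ᵥ ξ.2) (h := fun ξ => ξ.1 ⬝ᵥ D *ᵥ ξ.2)
    (isCompact_unitSphere.prod isCompact_unitSphere) ?_ ?_ ?_ ?_ ?_ ?_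
  · exact continuous_fst.dotProduct (continuous_const.matrix_mulVec continuous_snd)
  · exact continuous_fst.dotProduct (continuous_const.matrix_mulVec continuous_snd)
  · rintro ⟨y, z⟩ ⟨hy, hz⟩
    rw [hlamP]
    exact bilin_le_specNorm P hy hz
  · rintro ⟨y, z⟩ ⟨hy, hz⟩ hyz
    change ∑ i, y i ^ 2 = 1 at hy
    change ∑ j, z j ^ 2 = 1 at hz
    obtain ⟨y, rfl⟩ : ∃ y', U *ᵥ y' = y := ⟨Uᵀ *ᵥ y, by rw [mulVec_mulVec, hUU, one_mulVec]⟩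
    obtain ⟨z, rfl⟩ : ∃ z', V *ᵥ z' = z := ⟨Vᵀ *ᵥ z, by rw [mulVec_mulVec, hVV, one_mulVec]⟩
    rw [sum_sq_orthogonal_mulVec hU] at hy
    rw [sum_sq_orthogonal_mulVec hV] at hz
    simp only [hbilP] at hyz
    obtain ⟨h1, h2, h3⟩ := eq_of_bilin_diagRect_eq hmn hlam0
      (fun i => le_min (hσ0 i) hlam0.le) (fun i => min_le_right _ _) hy hz hyz
    simp only [bilin_transform]
    rw [bilin_eq_quadForm hmn _ h1 h2]
    exact hg y (fun i hi => h3 i (min_lt_of_left_lt hi)) hy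
  · obtain ⟨x, hx, hx1, hxg⟩ := hex
    obtain ⟨z, h1, h2⟩ := exists_zero_extension hmn x
    refine ⟨(U *ᵥ x, V *ᵥ z), ⟨?_, ?_⟩, ?_, ?_⟩
    · exact (sum_sq_orthogonal_mulVec hU x).trans hx1
    · exact (sum_sq_orthogonal_mulVec hV z).trans ((sum_sq_zero_extension hmn h1 h2).trans hx1)
    · simp only [hbilP, h1]
      refine Eq.trans ?_ (mul_one lam)
      rw [← hx1, Finset.mul_sum]
      refine Finset.sum_congr rfl fun i _ => ?_
      rcases lt_or_ge (σ i) lam with hi | hi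
      · simp [hx i hi]
      · rw [min_eq_right hi]
        ring
    · simp only [bilin_transform]
      rw [bilin_eq_quadForm hmn _ h1 h2, hxg]
  · intro t _
    have hlin : ∀ (y : Fin m → ℝ) (z : Fin n → ℝ),
        y ⬝ᵥ (P + t • D) *ᵥ z = y ⬝ᵥ P *ᵥ z + t * (y ⬝ᵥ D *ᵥ z) := by
      intro y z
      rw [add_mulVec, dotProduct_add, smul_mulVec, dotProduct_smul, smul_eq_mul]
    constructor
    · rintro _ ⟨⟨y, z⟩, ⟨hy, hz⟩, rfl⟩
      show y ⬝ᵥ P *ᵥ z + t * (y ⬝ᵥ D *ᵥ z) ≤ _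
      rw [← hlin]
      exact bilin_le_specNorm _ hy hz
    · intro c hc
      refine specNorm_le_of_bilin_le _ fun y z hy hz => ?_
      rw [hlin]
      exact hc ⟨(y, z), ⟨hy, hz⟩, rfl⟩

lemma exists_max_quadForm {m : ℕ} (S : Matrix (Fin m) (Fin m) ℝ) {σ : Fin m → ℝ} {lam : ℝ}
    (hα : ∃ i, lam ≤ σ i) :
    ∃ g, (∀ x : Fin m → ℝ, (∀ i, σ i < lam → x i = 0) → ∑ i, x i ^ 2 = 1 → quadForm S x ≤ g) ∧
      ∃ x : Fin m → ℝ, (∀ i, σ i < lam → x i = 0) ∧ ∑ i, x i ^ 2 = 1 ∧ quadForm S x = g := by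
  obtain ⟨i, hi⟩ := hα
  have hclosed : IsClosed {x : Fin m → ℝ | ∀ i, σ i < lam → x i = 0} := by
    simp only [Set.ofPred_forall]
    exact isClosed_iInter fun i => isClosed_iInter fun _ =>
      isClosed_eq (continuous_apply i) continuous_const
  have hne : ({x : Fin m → ℝ | ∑ i, x i ^ 2 = 1} ∩ {x | ∀ i, σ i < lam → x i = 0}).Nonempty := by
    refine ⟨Pi.single i 1, sum_sq_single i, fun k hk => ?_⟩
    have : k ≠ i := by rintro rfl; exact hk.not_ge hi
    simp [this]
  have hcont : Continuous (quadForm S) := by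
    unfold quadForm
    fun_prop
  obtain ⟨x, ⟨hx1, hx⟩, hmax⟩ :=
    (isCompact_unitSphere.inter_right hclosed).exists_isMaxOn hne hcont.continuousOn
  exact ⟨quadForm S x, fun y hy hy1 => hmax ⟨hy1, hy⟩, x, hx, hx1, rfl⟩

/-- Proposition 3.1 (i): characterization of the critical cone
`C_θ(P,W)` of the spectral norm. -/
theorem critTheta_mem_iff {m n : ℕ} (hmn : m ≤ n)
    (P W : Matrix (Fin m) (Fin n) ℝ) (hP : P ≠ 0)
    (hW : W ∈ subdiff specNorm P)
    (U : Matrix (Fin m) (Fin m) ℝ) (V : Matrix (Fin n) (Fin n) ℝ) (σ : Fin m → ℝ)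
    (hU : Uᵀ * U = 1) (hV : Vᵀ * V = 1)
    (hσa : Antitone σ) (hσ0 : ∀ i, 0 ≤ σ i)
    (hSVD : P + W = U * (diagRect σ : Matrix (Fin m) (Fin n) ℝ) * Vᵀ)
    (lam : ℝ) (hlam0 : 0 < lam) (hlamP : lam = specNorm P)
    (hlam1 : ∑ i, max (σ i - lam) 0 = 1)
    (hPdec : P = U * (diagRect (fun i => min (σ i) lam) : Matrix (Fin m) (Fin n) ℝ) * Vᵀ)
    (hWdec : W = U * (diagRect (fun i => max (σ i - lam) 0) : Matrix (Fin m) (Fin n) ℝ) * Vᵀ)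
    (D : Matrix (Fin m) (Fin n) ℝ) :
    D ∈ critTheta P W ↔
      ∃ τ : ℝ,
        -- λ_{|α₁|}(S(D̃_{α₁α₁})) ≥ τ (Rayleigh form; vacuous if α₁ = ∅)
        (∀ x : Fin m → ℝ, (∀ i, σ i ≠ lam + 1 → x i = 0) → ∑ i, x i ^ 2 = 1 →
          τ ≤ quadForm (symLeft hmn (Uᵀ * D * V)) x) ∧
        -- τ ≥ λ₁(S(D̃_{α₃α₃})) (Rayleigh form; vacuous if α₃ = ∅)
        (∀ x : Fin m → ℝ, (∀ i, σ i ≠ lam → x i = 0) → ∑ i, x i ^ 2 = 1 →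
          quadForm (symLeft hmn (Uᵀ * D * V)) x ≤ τ) ∧
        -- S(D̃_{αα}) = Diag( S(D̃_{α₁α₁}), τ·I_{|α₂|}, S(D̃_{α₃α₃}) )
        (∀ i j : Fin m, lam ≤ σ i → lam ≤ σ j →
          (blkIdx lam σ i ≠ blkIdx lam σ j → symLeft hmn (Uᵀ * D * V) i j = 0) ∧
          (blkIdx lam σ i = 2 → blkIdx lam σ j = 2 →
            symLeft hmn (Uᵀ * D * V) i j = if i = j then τ else 0)) := by
  obtain ⟨i₀, hi₀⟩ : ∃ i, lam ≤ σ i := by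
    by_contra! h
    rw [Finset.sum_eq_zero fun i _ => max_eq_right (by linarith [h i])] at hlam1
    exact zero_ne_one hlam1
  have : Nonempty (Fin m) := ⟨i₀⟩
  obtain ⟨g, hg, hex⟩ := exists_max_quadForm (symLeft hmn (Uᵀ * D * V)) ⟨i₀, hi₀⟩
  rw [critTheta, Set.mem_ofPred_eq,
    dirDeriv_specNorm_eq hmn hU hV hσ0 hlam0 hlamP hPdec D hg hex, hWdec,
    minner_mul_diagRect_mul hmn]
  refine max_eq_weighted_diag_iff (fun i j => ?_) hlam1 hg hex
  simp only [symLeft, of_apply]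
  rw [add_comm]

end
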